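/- arXiv:1711.04183 — 4 statements merged into one kernel-verified Lean document; each statement's English description precedes it below -/
import Mathlib

section
/- Let k be a prime and let A be a subset of {1,…,n} that contains no k-term arithmetic progression. Then the set A_k = {(a−1)·k + j : a ∈ A, 1 ≤ j ≤ k−1} also contains no k-term arithmetic progression. -/
/-- A set `S` of natural numbers contains a `k`-term arithmetic progression:
there are `a` and `d ≥ 1` with `a, a+d, …, a+(k-1)d` all in `S`. -/
def HasAP (k : ℕ) (S : Set ℕ) : Prop :=
  ∃ a d : ℕ, 1 ≤ d ∧ ∀ i < k, a + i * d ∈ S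

theorem exists_lt_dvd_add_mul {k d : ℕ} (hk : k.Prime) (hd : ¬ k ∣ d) (a : ℕ) :
    ∃ i < k, k ∣ a + i * d := by
  have : Fact k.Prime := ⟨hk⟩
  have hd' : (d : ZMod k) ≠ 0 := by rwa [Ne, ZMod.natCast_eq_zero_iff]
  refine ⟨(-(a : ZMod k) / d).val, ZMod.val_lt _, ?_⟩
  rw [← ZMod.natCast_eq_zero_iff]
  push_cast
  rw [ZMod.natCast_zmod_val, div_mul_cancel₀ _ hd', add_neg_cancel]

theorem apFree_blowup (k n : ℕ) (hk : k.Prime) (A : Set ℕ)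
    (hA : A ⊆ Set.Icc 1 n) (hfree : ¬ HasAP k A) :
    ¬ HasAP k {x : ℕ | ∃ a ∈ A, ∃ j : ℕ, 1 ≤ j ∧ j ≤ k - 1 ∧ x = (a - 1) * k + j} := by
  rintro ⟨b, d, hd, hAP⟩
  have hkpos := hk.pos
  by_cases hdvd : k ∣ d
  · obtain ⟨e, rfl⟩ := hdvd
    refine hfree ⟨b / k + 1, e, Nat.pos_of_mul_pos_left hd, fun i hi => ?_⟩
    obtain ⟨a, ha, j, -, hj, hx⟩ := hAP i hi
    have ha1 : 1 ≤ a := (hA ha).1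
    have hquot : b / k + i * e = a - 1 := by
      rw [← Nat.add_mul_div_right b (i * e) hkpos, mul_assoc i e k, mul_comm e k, hx,
        mul_comm, Nat.mul_add_div hkpos, Nat.div_eq_of_lt (by omega), add_zero]
    have : b / k + 1 + i * e = a := by omega
    rwa [this]
  · obtain ⟨i, hi, hdiv⟩ := exists_lt_dvd_add_mul hk hdvd b
    obtain ⟨a, -, j, hj1, hj, hx⟩ := hAP i hi
    rw [hx, Nat.dvd_add_right (Dvd.intro_left _ rfl)] at hdiv
    have := Nat.le_of_dvd hj1 hdiv
    omega
end

section
/- If k is a prime with k ≥ 3 and r is a positive integer, then (k−1)^r ≤ r_k(k^r). -/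
/-- `rk k n` is the maximum size of a `k`-AP-free subset of `{1, …, n}`. -/
noncomputable def rk (k n : ℕ) : ℕ :=
  sSup {m | ∃ A : Finset ℕ, A ⊆ Finset.Icc 1 n ∧ ¬ HasAP k ↑A ∧ A.card = m}

theorem exists_add_mul_mod_eq {k : ℕ} (hk : k.Prime) (a d c : ℕ) (hd : ¬ k ∣ d) (hc : c < k) :
    ∃ i < k, (a + i * d) % k = c := by
  have : Fact k.Prime := ⟨hk⟩
  have hd' : (d : ZMod k) ≠ 0 := by rwa [Ne, ZMod.natCast_eq_zero_iff]
  refine ⟨(((c : ZMod k) - a) / d).val, ZMod.val_lt _, ?_⟩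
  have h : ((a + (((c : ZMod k) - a) / d).val * d : ℕ) : ZMod k) = (c : ℕ) := by
    push_cast
    rw [ZMod.natCast_zmod_val, div_mul_cancel₀ _ hd', add_sub_cancel]
  rw [ZMod.natCast_eq_natCast_iff', Nat.mod_eq_of_lt hc] at h
  exact h

/-- The witness is the set of `n < k ^ r` whose base-`k` digits all differ from `k - 1`. -/
theorem exists_not_hasAP_subset_range {k : ℕ} (hk : k.Prime) (r : ℕ) :
    ∃ A : Finset ℕ, A ⊆ Finset.range (k ^ r) ∧ ¬ HasAP k ↑A ∧ A.card = (k - 1) ^ r := by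
  have hk2 := hk.two_le
  induction r with
  | zero =>
    refine ⟨{0}, by simp, ?_, by simp⟩
    rintro ⟨a, d, hd, h⟩
    have h1 := h 1 (by omega)
    simp only [Finset.coe_singleton, Set.mem_singleton_iff] at h1
    omega
  | succ r ih =>
    obtain ⟨A, hA, hAP, hcard⟩ := ih
    have key : ∀ q c, c < k - 1 → (k * q + c) % k = c ∧ (k * q + c) / k = q := by
      intro q c hc
      have hck : c < k := by omega
      rw [Nat.mul_add_mod, Nat.mul_add_div (by omega), Nat.mod_eq_of_lt hck,
        Nat.div_eq_of_lt hck]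
      simp
    refine ⟨(A ×ˢ Finset.range (k - 1)).image fun p => k * p.1 + p.2, ?_, ?_, ?_⟩
    · intro x hx
      simp only [Finset.mem_image, Finset.mem_product, Finset.mem_range] at hx ⊢
      obtain ⟨⟨q, c⟩, ⟨hq, hc⟩, rfl⟩ := hx
      have hq' : q + 1 ≤ k ^ r := Finset.mem_range.1 (hA hq)
      have hmul := Nat.mul_le_mul_left k hq'
      rw [pow_succ, mul_comm (k ^ r)]
      dsimp only at hc ⊢
      rw [mul_add] at hmul
      omega
    · rintro ⟨a, d, hd, h⟩
      have hdigits : ∀ i < k, (a + i * d) % k < k - 1 ∧ (a + i * d) / k ∈ A := by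
        intro i hi
        have hx := h i hi
        simp only [Finset.coe_image, Set.mem_image, Finset.mem_coe, Finset.mem_product,
          Finset.mem_range] at hx
        obtain ⟨⟨q, c⟩, ⟨hq, hc⟩, hx⟩ := hx
        rw [← hx, (key q c hc).1, (key q c hc).2]
        exact ⟨hc, hq⟩
      by_cases hkd : k ∣ d
      · obtain ⟨e, rfl⟩ := hkd
        refine hAP ⟨a / k, e, Nat.pos_of_mul_pos_left hd, fun i hi => ?_⟩
        have hi' := (hdigits i hi).2
        rwa [mul_left_comm, Nat.add_mul_div_left _ _ hk.pos] at hi'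
      · obtain ⟨i, hi, hmod⟩ := exists_add_mul_mod_eq hk a d (k - 1) hkd (by omega)
        have := (hdigits i hi).1
        omega
    · rw [Finset.card_image_of_injOn, Finset.card_product, hcard, Finset.card_range, pow_succ]
      rintro ⟨q, c⟩ hp ⟨q', c'⟩ hp' heq
      simp only [Finset.mem_coe, Finset.mem_product, Finset.mem_range] at hp hp' heq
      have h1 := key q c hp.2
      rw [heq, (key q' c' hp'.2).1, (key q' c' hp'.2).2] at h1
      rw [h1.1, h1.2]

theorem HasAP.of_image_succ {k : ℕ} (hk : 0 < k) {A : Set ℕ} (h : HasAP k (Nat.succ '' A)) :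
    HasAP k A := by
  obtain ⟨a, d, hd, h⟩ := h
  refine ⟨a - 1, d, hd, fun i hi => ?_⟩
  obtain ⟨x, -, hx⟩ := h 0 hk
  obtain ⟨y, hy, hxy⟩ := h i hi
  have : a - 1 + i * d = y := by omega
  rwa [this]

theorem card_le_rk {k n : ℕ} {A : Finset ℕ} (hA : A ⊆ Finset.Icc 1 n) (hAP : ¬ HasAP k ↑A) :
    A.card ≤ rk k n := by
  refine le_csSup ⟨(Finset.Icc 1 n).card, ?_⟩ ⟨A, hA, hAP, rfl⟩
  rintro m ⟨B, hB, -, rfl⟩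
  exact Finset.card_le_card hB

theorem rk_pow_lower (k r : ℕ) (hk : k.Prime) (hk3 : 3 ≤ k) (hr : 1 ≤ r) :
    (k - 1) ^ r ≤ rk k (k ^ r) := by
  obtain ⟨A, hA, hAP, hcard⟩ := exists_not_hasAP_subset_range hk r
  rw [← hcard, ← Finset.card_image_of_injective A Nat.succ_injective]
  refine card_le_rk (fun x hx => ?_) fun h => hAP ?_
  · obtain ⟨y, hy, rfl⟩ := Finset.mem_image.1 hx
    have := Finset.mem_range.1 (hA hy)
    exact Finset.mem_Icc.2 ⟨by omega, this⟩
  · rw [Finset.coe_image] at h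
    exact h.of_image_succ hk.pos
end

section
/- Fix a positive integer d, a constant c > 0, real numbers s and ε with ε > 0 and s − ε > 1, and define h : ℝ → ℝ by h(x) = c·x / ((∏_{i=1}^{d−1} ln^{(i)}(x))·(ln^{(d)}(x))^s) and g : ℝ → ℝ by g(x) = x·(∏_{i=1}^{d−1} ln^{(i)}(x))·(ln^{(d)}(x))^{s−ε}. Then there exists N such that h(g(x)) < x for all real x > N. -/
theorem tendsto_iterate_log_atTop (n : ℕ) :
    Filter.Tendsto (Real.log^[n]) Filter.atTop Filter.atTop :=
  Real.tendsto_log_atTop.iterate n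

theorem iterate_log_le_iterate_log {x y : ℝ} (hxy : x ≤ y) (n : ℕ)
    (hx : ∀ i < n, 0 < Real.log^[i] x) : Real.log^[n] x ≤ Real.log^[n] y := by
  induction n with
  | zero => simpa using hxy
  | succ n ih =>
    rw [Function.iterate_succ_apply', Function.iterate_succ_apply']
    exact Real.log_le_log (hx n n.lt_succ_self) (ih fun i hi => hx i (hi.trans n.lt_succ_self))

theorem composed_shrinks (d : ℕ) (hd : 1 ≤ d) (c s ε : ℝ)
    (hc : 0 < c) (hε : 0 < ε) (hs : 1 < s - ε) :
    ∃ N : ℝ, ∀ x : ℝ, N < x →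
      c * (x * (∏ i ∈ Finset.Icc 1 (d - 1), Real.log^[i] x) * (Real.log^[d] x) ^ (s - ε)) /
          ((∏ i ∈ Finset.Icc 1 (d - 1),
              Real.log^[i]
                (x * (∏ j ∈ Finset.Icc 1 (d - 1), Real.log^[j] x) *
                  (Real.log^[d] x) ^ (s - ε))) *
            (Real.log^[d]
                (x * (∏ j ∈ Finset.Icc 1 (d - 1), Real.log^[j] x) *
                  (Real.log^[d] x) ^ (s - ε))) ^ s)
        < x := by
  have hlog : ∀ᶠ x : ℝ in Filter.atTop, ∀ i ∈ Finset.range (d + 1), 1 ≤ Real.log^[i] x :=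
    (Finset.eventually_all _).2 fun i _ =>
      (tendsto_iterate_log_atTop i).eventually_ge_atTop 1
  have hpow : ∀ᶠ x : ℝ in Filter.atTop, c < (Real.log^[d] x) ^ ε :=
    ((tendsto_rpow_atTop hε).comp (tendsto_iterate_log_atTop d)).eventually_gt_atTop c
  obtain ⟨N, hN⟩ := Filter.eventually_atTop.1 (hlog.and hpow)
  refine ⟨N, fun x hx => ?_⟩
  obtain ⟨hone, hcL⟩ := hN x hx.le
  replace hone : ∀ i ≤ d, 1 ≤ Real.log^[i] x := fun i hi =>
    hone i (Finset.mem_range.2 (Nat.lt_succ_of_le hi))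
  have hx1 : 1 ≤ x := hone 0 d.zero_le
  have hL : 1 ≤ Real.log^[d] x := hone d le_rfl
  have hmem : ∀ i ∈ Finset.Icc 1 (d - 1), i ≤ d := fun i hi =>
    (Finset.mem_Icc.1 hi).2.trans (Nat.sub_le d 1)
  have hP : 1 ≤ ∏ i ∈ Finset.Icc 1 (d - 1), Real.log^[i] x :=
    Finset.one_le_prod fun i hi => hone i (hmem i hi)
  have hLp : 1 ≤ (Real.log^[d] x) ^ (s - ε) := Real.one_le_rpow hL (by linarith)
  have hg : x ≤ x * (∏ j ∈ Finset.Icc 1 (d - 1), Real.log^[j] x) *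
      (Real.log^[d] x) ^ (s - ε) := by
    rw [mul_assoc]
    exact le_mul_of_one_le_right (by linarith) (one_le_mul_of_one_le_of_one_le hP hLp)
  have hmono : ∀ i ≤ d, Real.log^[i] x ≤ Real.log^[i]
      (x * (∏ j ∈ Finset.Icc 1 (d - 1), Real.log^[j] x) * (Real.log^[d] x) ^ (s - ε)) :=
    fun i hi => iterate_log_le_iterate_log hg i fun j hj =>
      one_pos.trans_le (hone j (hj.le.trans hi))
  have hprod : ∏ i ∈ Finset.Icc 1 (d - 1), Real.log^[i] x ≤
      ∏ i ∈ Finset.Icc 1 (d - 1), Real.log^[i]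
        (x * (∏ j ∈ Finset.Icc 1 (d - 1), Real.log^[j] x) * (Real.log^[d] x) ^ (s - ε)) :=
    Finset.prod_le_prod (fun i hi => zero_le_one.trans (hone i (hmem i hi)))
      fun i hi => hmono i (hmem i hi)
  have hLs := Real.rpow_le_rpow (zero_le_one.trans hL) (hmono d le_rfl)
    (show 0 ≤ s by linarith)
  have hsplit : (Real.log^[d] x) ^ s = (Real.log^[d] x) ^ (s - ε) * (Real.log^[d] x) ^ ε := by
    rw [← Real.rpow_add (by linarith), sub_add_cancel]
  have hden := mul_le_mul hprod hLs (by positivity) (by linarith)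
  have hPpos := one_pos.trans_le hP
  have hLpos := one_pos.trans_le hL
  rw [div_lt_iff₀ (lt_of_lt_of_le (by positivity) hden)]
  refine lt_of_lt_of_le ?_ (mul_le_mul_of_nonneg_left hden (by linarith))
  rw [hsplit]
  calc _ < (Real.log^[d] x) ^ ε * (x * (∏ i ∈ Finset.Icc 1 (d - 1), Real.log^[i] x) *
        (Real.log^[d] x) ^ (s - ε)) := mul_lt_mul_of_pos_right hcL (by positivity)
    _ = _ := by ring
end

section
/- Let k ≥ 3 be an integer. Suppose there exist a positive integer d, a constant c > 0, and N such that for all integers n > N, c·n / ∏_{i=1}^{d} ln^{(i)}(n) ≤ r_k(n). Then there exists an infinite set A of positive integers containing no k-term arithmetic progression such that the sum of the reciprocals of the elements of A diverges. -/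
open Filter

/-- The supremum defining `rk` is attained. -/
theorem exists_card_eq_rk {k : ℕ} (hk : 0 < k) (n : ℕ) :
    ∃ A : Finset ℕ, A ⊆ Finset.Icc 1 n ∧ ¬ HasAP k ↑A ∧ A.card = rk k n := by
  have hne : {m | ∃ A : Finset ℕ, A ⊆ Finset.Icc 1 n ∧ ¬ HasAP k ↑A ∧ A.card = m}.Nonempty := by
    refine ⟨0, ∅, by simp, ?_, by simp⟩
    rintro ⟨a, d, -, h⟩
    simpa using h 0 hk
  refine Nat.sSup_mem hne ⟨n, ?_⟩
  rintro m ⟨A, hA, -, rfl⟩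
  simpa using Finset.card_le_card hA

/-- The union of the blocks `2 * 4 ^ j + B j`, meant for `B j ⊆ {1, …, 4 ^ j}`. -/
def translatedUnion (B : ℕ → Finset ℕ) : Set ℕ :=
  {x | ∃ j, ∃ b ∈ B j, x = 2 * 4 ^ j + b}

theorem index_le_of_lt_of_lt {i j x : ℕ} (hi : 2 * 4 ^ i < x) (hj : x < 8 * 4 ^ j) :
    i ≤ j := by
  by_contra! h
  have := Nat.pow_le_pow_right (show 0 < 4 by norm_num) (Nat.succ_le_of_lt h)
  rw [pow_succ] at this
  omega

/-- The blocks are so far apart that three terms in progression share a block. -/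
theorem index_eq_of_add_eq_two_mul {i j l a b c : ℕ}
    (ha : 2 * 4 ^ i < a ∧ a ≤ 3 * 4 ^ i) (hb : 2 * 4 ^ j < b ∧ b ≤ 3 * 4 ^ j)
    (hc : 2 * 4 ^ l < c ∧ c ≤ 3 * 4 ^ l) (hab : a < b) (h : a + c = 2 * b) :
    i = j ∧ l = j := by
  have hlj : l = j := le_antisymm (index_le_of_lt_of_lt hc.1 (by omega))
    (index_le_of_lt_of_lt hb.1 (by omega))
  subst hlj
  refine ⟨le_antisymm (index_le_of_lt_of_lt ha.1 (by omega)) ?_, rfl⟩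
  by_contra! hlt
  have := Nat.pow_le_pow_right (show 0 < 4 by norm_num) (Nat.succ_le_of_lt hlt)
  rw [pow_succ] at this
  omega

theorem not_hasAP_translatedUnion {k : ℕ} (hk : 3 ≤ k) {B : ℕ → Finset ℕ}
    (hB : ∀ j, B j ⊆ Finset.Icc 1 (4 ^ j)) (hAP : ∀ j, ¬ HasAP k (B j : Set ℕ)) :
    ¬ HasAP k (translatedUnion B) := by
  rintro ⟨a, d, hd, h⟩
  choose! J b hb hx using h
  have hbd : ∀ i < k, 2 * 4 ^ J i < a + i * d ∧ a + i * d ≤ 3 * 4 ^ J i := by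
    intro i hi
    have h1 := hx i hi
    have h2 := Finset.mem_Icc.1 (hB _ (hb i hi))
    omega
  have hstep : ∀ i, i + 2 < k → J i = J (i + 1) ∧ J (i + 2) = J (i + 1) := fun i hi =>
    index_eq_of_add_eq_two_mul (hbd i (by omega)) (hbd (i + 1) (by omega)) (hbd (i + 2) hi)
      (by rw [add_mul]; omega) (by ring)
  have hJ : ∀ i < k, J i = J 0 := by
    intro i
    induction i with
    | zero => simp
    | succ i ih =>
      intro hi
      rw [← ih (by omega)]
      rcases i with _ | i
      · exact (hstep 0 (by omega)).1.symm
      · exact (hstep i hi).2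
  have h0 := hx 0 (by omega)
  refine hAP (J 0) ⟨b 0, d, hd, fun i hi => ?_⟩
  have h1 := hb i hi
  have h2 := hx i hi
  rw [hJ i hi] at h1 h2
  have : b 0 + i * d = b i := by omega
  rw [this]
  exact h1

theorem summable_card_div_of_summable {B : ℕ → Finset ℕ}
    (hB : ∀ j, B j ⊆ Finset.Icc 1 (4 ^ j))
    (hs : Summable (fun a : translatedUnion B => (1 : ℝ) / (a : ℕ))) :
    Summable (fun j => ((B j).card : ℝ) / (3 * 4 ^ j)) := by
  let φ : (Σ j, B j) → translatedUnion B := fun p => ⟨2 * 4 ^ p.1 + p.2, p.1, p.2, p.2.2, rfl⟩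
  have hφ : Function.Injective φ := by
    rintro ⟨i, x, hx⟩ ⟨j, y, hy⟩ h
    have h' : 2 * 4 ^ i + x = 2 * 4 ^ j + y := congrArg Subtype.val h
    have h1 := Finset.mem_Icc.1 (hB _ hx)
    have h2 := Finset.mem_Icc.1 (hB _ hy)
    obtain rfl : i = j := le_antisymm
      (index_le_of_lt_of_lt (x := 2 * 4 ^ i + x) (by omega) (by omega))
      (index_le_of_lt_of_lt (x := 2 * 4 ^ i + x) (by omega) (by omega))
    obtain rfl : x = y := by omega
    rfl
  refine Summable.of_nonneg_of_le (fun j => by positivity) (fun j => ?_) (hs.comp_injective hφ).sigma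
  rw [tsum_fintype]
  have : ∀ b : B j, (1 : ℝ) / (3 * 4 ^ j) ≤
      ((fun a : translatedUnion B => (1 : ℝ) / (a : ℕ)) ∘ φ) ⟨j, b⟩ := by
    intro b
    have h2 := Finset.mem_Icc.1 (hB _ b.2)
    refine one_div_le_one_div_of_le (Nat.cast_pos.2 (show 0 < 2 * 4 ^ j + (b : ℕ) by omega)) ?_
    have h3 : 2 * 4 ^ j + (b : ℕ) ≤ 3 * 4 ^ j := by omega
    exact_mod_cast h3
  calc ((B j).card : ℝ) / (3 * 4 ^ j) = ∑ _b : B j, (1 : ℝ) / (3 * 4 ^ j) := by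
        simp [div_eq_mul_inv]
    _ ≤ _ := Finset.sum_le_sum fun b _ => this b

theorem tendsto_log_iterate_atTop (m : ℕ) : Tendsto (Real.log^[m]) atTop atTop := by
  induction m with
  | zero => exact tendsto_id
  | succ m ih => exact ih.comp Real.tendsto_log_atTop

/-- Increment bound for iterated logarithms, the discrete form of
`(log^[m + 1])' = 1 / (x * log x * ⋯ * log^[m] x)`. -/
theorem log_iterate_sub_le {x y : ℝ} (hxy : Real.log x ≤ Real.log y) (m : ℕ)
    (hpos : ∀ i ∈ Finset.Icc 1 m, 0 < Real.log^[i] x) :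
    Real.log^[m + 1] x ≤ Real.log^[m + 1] y ∧
      Real.log^[m + 1] y - Real.log^[m + 1] x ≤
        (Real.log y - Real.log x) / ∏ i ∈ Finset.Icc 1 m, Real.log^[i] x := by
  induction m with
  | zero => simpa using hxy
  | succ m ih =>
    obtain ⟨h1, h2⟩ := ih fun i hi => hpos i (Finset.Icc_subset_Icc_right (by omega) hi)
    have ha : 0 < Real.log^[m + 1] x := hpos _ (by simp)
    rw [Finset.prod_Icc_succ_top (by omega), ← div_div,
      Function.iterate_succ_apply' _ (m + 1) x, Function.iterate_succ_apply' _ (m + 1) y]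
    refine ⟨Real.log_le_log ha h1, ?_⟩
    rw [← Real.log_div (ha.trans_le h1).ne' ha.ne']
    calc _ ≤ Real.log^[m + 1] y / Real.log^[m + 1] x - 1 :=
          Real.log_le_sub_one_of_pos (div_pos (ha.trans_le h1) ha)
      _ = (Real.log^[m + 1] y - Real.log^[m + 1] x) / Real.log^[m + 1] x := by
          field_simp
      _ ≤ _ := by gcongr

theorem not_summable_of_tendsto_atTop_of_sub_le {u v : ℕ → ℝ} (hu : Tendsto u atTop atTop)
    (hv : ∀ n, 0 ≤ v n) (h : ∀ᶠ n in atTop, u (n + 1) - u n ≤ v n) : ¬ Summable v := by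
  intro hs
  obtain ⟨J, hJ⟩ := eventually_atTop.1 h
  have hs' := (summable_nat_add_iff J).2 hs
  have hb : ∀ n, u (n + J) ≤ u J + ∑' i, v (i + J) := by
    intro n
    have h1 := Finset.sum_range_sub (fun i => u (i + J)) n
    have h2 : ∑ i ∈ Finset.range n, (u (i + 1 + J) - u (i + J)) ≤
        ∑ i ∈ Finset.range n, v (i + J) := Finset.sum_le_sum fun i _ => by
      rw [add_right_comm]
      exact hJ _ (by omega)
    have h3 := hs'.sum_le_tsum (Finset.range n) fun i _ => hv _
    simp only [zero_add] at h1
    linarith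
  obtain ⟨n, hn⟩ := (((tendsto_add_atTop_iff_nat J).2 hu).eventually_gt_atTop
    (u J + ∑' i, v (i + J))).exists
  exact (hb n).not_gt hn

theorem large_apFree_set_of_lower_bound (k : ℕ) (hk : 3 ≤ k)
    (hyp : ∃ d : ℕ, 1 ≤ d ∧ ∃ c : ℝ, 0 < c ∧ ∃ N : ℕ, ∀ n : ℕ, N < n →
      c * (n : ℝ) / (∏ i ∈ Finset.Icc 1 d, Real.log^[i] (n : ℝ)) ≤ (rk k n : ℝ)) :
    ∃ A : Set ℕ, A.Infinite ∧ (∀ x ∈ A, 1 ≤ x) ∧ ¬ HasAP k A ∧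
      ¬ Summable (fun a : A => (1 : ℝ) / (a : ℕ)) := by
  obtain ⟨d, -, c, hc, N, hN⟩ := hyp
  choose B hB hAP hcard using fun j : ℕ => exists_card_eq_rk (by omega : 0 < k) (4 ^ j)
  have htend : Tendsto (fun j : ℕ => (4 : ℝ) ^ j) atTop atTop :=
    tendsto_pow_atTop_atTop_of_one_lt (by norm_num)
  have hns : ¬ Summable (fun a : translatedUnion B => (1 : ℝ) / (a : ℕ)) := by
    intro hs
    have hs := (summable_card_div_of_summable hB hs).mul_left (3 * Real.log 4 / c)
    refine not_summable_of_tendsto_atTop_of_sub_le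
      ((tendsto_log_iterate_atTop (d + 1)).comp htend) (fun j => ?_) ?_ hs
    · have : 0 ≤ Real.log 4 := Real.log_nonneg (by norm_num)
      positivity
    have hpos : ∀ᶠ j : ℕ in atTop, ∀ i ∈ Finset.Icc 1 d, 0 < Real.log^[i] ((4 : ℝ) ^ j) :=
      (eventually_all_finset _).2 fun i _ =>
        ((tendsto_log_iterate_atTop i).comp htend).eventually_gt_atTop 0
    filter_upwards [hpos, eventually_ge_atTop N] with j hj hjN
    have hlog : Real.log (4 ^ (j + 1)) - Real.log (4 ^ j) = Real.log 4 := by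
      rw [Real.log_pow, Real.log_pow]
      push_cast
      ring
    have h4 : 0 < Real.log 4 := Real.log_pos (by norm_num)
    have h1 := (log_iterate_sub_le (x := 4 ^ j) (y := 4 ^ (j + 1)) (by linarith) d hj).2
    have h2 := hN (4 ^ j) (hjN.trans_lt (Nat.lt_pow_self (by norm_num)))
    rw [hlog] at h1
    push_cast at h2
    rw [← hcard j] at h2
    have hP := Finset.prod_pos hj
    refine h1.trans ?_
    calc Real.log 4 / ∏ i ∈ Finset.Icc 1 d, Real.log^[i] ((4 : ℝ) ^ j)
        = 3 * Real.log 4 / c * ((c * 4 ^ j / ∏ i ∈ Finset.Icc 1 d, Real.log^[i] ((4 : ℝ) ^ j)) /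
            (3 * 4 ^ j)) := by
          field_simp
      _ ≤ _ := by gcongr
  refine ⟨translatedUnion B, fun hfin => ?_, ?_, not_hasAP_translatedUnion hk hB hAP, hns⟩
  · have := hfin.to_subtype
    exact hns Summable.of_finite
  · rintro x ⟨j, b, hb, rfl⟩
    have := Finset.mem_Icc.1 (hB j hb)
    omega
end
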